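/- Let α > 0 and C_0 > 0. If d_n ≤ C_0 · n^{−α} for all n ≥ 1, then σ_n ≤ C_1 · n^{−α} for all n ≥ 1, where C_1 := 2^{5α+1} · γ^{−2} · C_0. -/

import Mathlib

open Metric Submodule

section WeakGreedy

open Module InnerProductSpace

variable {E : Type*} [NormedAddCommGroup E] [InnerProductSpace ℝ E]

theorem Submodule.det_smul_starProjection_add_smul_sub [FiniteDimensional ℝ E]
    (W : Submodule ℝ E) (r s : ℝ) :
    LinearMap.det (r • (W.starProjection : E →ₗ[ℝ] E) +
      s • (LinearMap.id - (W.starProjection : E →ₗ[ℝ] E))) =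
      r ^ finrank ℝ W * s ^ finrank ℝ Wᗮ := by
  set T : E →ₗ[ℝ] E := r • (W.starProjection : E →ₗ[ℝ] E) +
    s • (LinearMap.id - (W.starProjection : E →ₗ[ℝ] E)) with hT
  let e := W.prodEquivOfIsCompl _ W.isCompl_orthogonal
  have key : (e.symm : E →ₗ[ℝ] W × Wᗮ) ∘ₗ T ∘ₗ (e.symm.symm : W × Wᗮ →ₗ[ℝ] E) =
      LinearMap.prodMap (r • LinearMap.id) (s • LinearMap.id) := by
    apply LinearMap.ext
    rintro ⟨u, v⟩
    have h1 : W.starProjection (u : E) = u := W.starProjection_mem_subspace_eq_self u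
    have h2 : W.starProjection (v : E) = 0 := W.starProjection_apply_eq_zero_iff.2 v.2
    have : T (u + v) = e (r • u, s • v) := by
      simp [hT, e, h1, h2]
    simp only [LinearMap.comp_apply, LinearEquiv.coe_coe, LinearEquiv.symm_symm]
    rw [show e (u, v) = (u : E) + v from rfl, this, e.symm_apply_apply]
    rfl
  rw [← LinearMap.det_conj _ e.symm, key, LinearMap.det_prodMap, LinearMap.det_smul,
    LinearMap.det_smul, LinearMap.det_id, LinearMap.det_id, mul_one, mul_one]

theorem Submodule.norm_sq_smul_starProjection_add_smul_sub (W : Submodule ℝ E)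
    [W.HasOrthogonalProjection] (r s : ℝ) (x : E) :
    ‖r • W.starProjection x + s • (x - W.starProjection x)‖ ^ 2 =
      r ^ 2 * ‖W.starProjection x‖ ^ 2 + s ^ 2 * ‖x - W.starProjection x‖ ^ 2 := by
  have h : inner ℝ (W.starProjection x) (x - W.starProjection x) = 0 := by
    rw [real_inner_comm]
    exact W.starProjection_inner_eq_zero x _ (W.starProjection_apply_mem x)
  rw [norm_add_sq_real, real_inner_smul_left, real_inner_smul_right, h, norm_smul, norm_smul,
    mul_pow, mul_pow, Real.norm_eq_abs, Real.norm_eq_abs, sq_abs, sq_abs]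
  ring

theorem Submodule.norm_sub_starProjection_le (W : Submodule ℝ E) [W.HasOrthogonalProjection]
    (x : E) {w : E} (hw : w ∈ W) : ‖x - W.starProjection x‖ ≤ ‖x - w‖ := by
  rw [W.starProjection_minimal x]
  have hbdd : BddBelow (Set.range fun v : W => ‖x - v‖) :=
    ⟨0, by rintro _ ⟨_, rfl⟩; exact norm_nonneg _⟩
  exact ciInf_le hbdd ⟨w, hw⟩

theorem InnerProductSpace.le_norm_gramSchmidt {n : ℕ} {x : Fin n → E} {a : ℝ} {i : Fin n}
    (ha : ∀ z ∈ span ℝ (x '' Set.Iio i), a ≤ ‖x i - z‖) : a ≤ ‖gramSchmidt ℝ x i‖ := by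
  rw [gramSchmidt_def]
  refine ha _ (sum_mem fun j hj => ?_)
  rw [← span_gramSchmidt_Iio]
  have hj' : gramSchmidt ℝ x j ∈ gramSchmidt ℝ x '' Set.Iio i :=
    Set.mem_image_of_mem _ (Finset.mem_Iio.1 hj)
  exact span_mono (Set.singleton_subset_iff.2 hj') (starProjection_apply_mem _ _)

theorem inner_gramSchmidtNormed_self {n : ℕ} (x : Fin n → E) (i : Fin n) :
    inner ℝ (gramSchmidtNormed ℝ x i) (x i) = ‖gramSchmidt ℝ x i‖ := by
  have h : inner ℝ (gramSchmidt ℝ x i) (x i) = ‖gramSchmidt ℝ x i‖ ^ 2 := by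
    conv_lhs => rw [gramSchmidt_def' ℝ x i, inner_add_right, inner_sum]
    rw [Finset.sum_eq_zero, add_zero, real_inner_self_eq_norm_sq]
    intro j hj
    rw [starProjection_singleton, inner_smul_right,
      gramSchmidt_orthogonal ℝ x (Finset.mem_Iio.1 hj).ne', mul_zero]
  rw [gramSchmidtNormed, inner_smul_left, h]
  by_cases h0 : ‖gramSchmidt ℝ x i‖ = 0
  · simp [h0]
  · simp; field_simp

/-- Lower bound for the determinant of a family in terms of its successive distances. -/
theorem exists_orthonormalBasis_prod_le_abs_det {n : ℕ} [FiniteDimensional ℝ E]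
    (hE : finrank ℝ E = n) (x : Fin n → E) {a : Fin n → ℝ} (ha0 : ∀ i, 0 < a i)
    (ha : ∀ i, ∀ z ∈ span ℝ (x '' Set.Iio i), a i ≤ ‖x i - z‖) :
    ∃ b : OrthonormalBasis (Fin n) ℝ E, ∏ i, a i ≤ |b.toBasis.det x| := by
  have hE' : finrank ℝ E = Fintype.card (Fin n) := by simpa using hE
  refine ⟨gramSchmidtOrthonormalBasis hE' x, ?_⟩
  rw [gramSchmidtOrthonormalBasis_det, Finset.abs_prod]
  refine Finset.prod_le_prod (fun i _ => (ha0 i).le) fun i _ => ?_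
  have hle := le_norm_gramSchmidt (ha i)
  have hne : gramSchmidtNormed ℝ x i ≠ 0 := by
    intro h0
    have := inner_gramSchmidtNormed_self x i
    rw [h0, inner_zero_left] at this
    linarith [ha0 i]
  rw [gramSchmidtOrthonormalBasis_apply hE' hne, inner_gramSchmidtNormed_self]
  exact hle.trans (le_abs_self _)

theorem OrthonormalBasis.abs_det_le_prod_norm {n : ℕ} (b : OrthonormalBasis (Fin n) ℝ E)
    (y : Fin n → E) : |b.toBasis.det y| ≤ ∏ i, ‖y i‖ := by
  have : Fact (finrank ℝ E = n) := ⟨by simpa using finrank_eq_card_basis b.toBasis⟩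
  rw [← b.toBasis.orientation.volumeForm_robust b rfl]
  exact Orientation.abs_volumeForm_apply_le _ y

theorem prod_dist_le_of_finrank_eq {m : ℕ} [FiniteDimensional ℝ E]
    (hE : finrank ℝ E = 2 * m) (x : Fin (2 * m) → E) {a : Fin (2 * m) → ℝ} (ha0 : ∀ i, 0 < a i)
    (ha : ∀ i, ∀ z ∈ span ℝ (x '' Set.Iio i), a i ≤ ‖x i - z‖)
    (W : Submodule ℝ E) (hW : finrank ℝ W ≤ m) {τ ρ : ℝ} (hρ : 0 < ρ) (hρτ : ρ ≤ τ)
    (hx : ∀ i, ‖x i‖ ≤ τ) (hxW : ∀ i, ∃ w ∈ W, ‖x i - w‖ ≤ ρ) :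
    ∏ i, a i ≤ (2 * τ * ρ) ^ m := by
  obtain ⟨b, hb⟩ := exists_orthonormalBasis_prod_le_abs_det hE x ha0 ha
  have hτ : 0 < τ := hρ.trans_le hρτ
  set r : ℝ := √(ρ / τ) with hr
  have hr2 : r ^ 2 = ρ / τ := Real.sq_sqrt (by positivity)
  have hr0 : 0 < r := Real.sqrt_pos.2 (by positivity)
  have hr1 : r ≤ 1 := Real.sqrt_le_one.2 ((div_le_one hτ).2 hρτ)
  set D : E →ₗ[ℝ] E := r • (W.starProjection : E →ₗ[ℝ] E) +
    r⁻¹ • (LinearMap.id - (W.starProjection : E →ₗ[ℝ] E)) with hD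
  have hdet : 1 ≤ |LinearMap.det D| := by
    rw [W.det_smul_starProjection_add_smul_sub]
    have h1 : finrank ℝ W + finrank ℝ Wᗮ = 2 * m := hE ▸ W.finrank_add_finrank_orthogonal
    obtain ⟨k, hk⟩ : ∃ k, finrank ℝ Wᗮ = finrank ℝ W + k := ⟨_, (Nat.add_sub_of_le (by lia)).symm⟩
    rw [hk, pow_add, ← mul_assoc, ← mul_pow, mul_inv_cancel₀ hr0.ne', one_pow, one_mul]
    exact (one_le_pow₀ ((one_le_inv₀ hr0).2 hr1)).trans (le_abs_self _)
  have hnorm : ∀ i, ‖D (x i)‖ ^ 2 ≤ 2 * τ * ρ := by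
    intro i
    have h1 : ‖W.starProjection (x i)‖ ≤ τ := (W.norm_starProjection_apply_le _).trans (hx i)
    have h2 : ‖x i - W.starProjection (x i)‖ ≤ ρ := by
      obtain ⟨w, hw, hwρ⟩ := hxW i
      exact (W.norm_sub_starProjection_le _ hw).trans hwρ
    calc ‖D (x i)‖ ^ 2
        = r ^ 2 * ‖W.starProjection (x i)‖ ^ 2
          + r⁻¹ ^ 2 * ‖x i - W.starProjection (x i)‖ ^ 2 :=
          W.norm_sq_smul_starProjection_add_smul_sub r r⁻¹ (x i)
      _ ≤ r ^ 2 * τ ^ 2 + r⁻¹ ^ 2 * ρ ^ 2 := by gcongr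
      _ = 2 * τ * ρ := by rw [inv_pow, hr2]; field_simp; ring
  calc ∏ i, a i ≤ |b.toBasis.det x| := hb
    _ ≤ |LinearMap.det D| * |b.toBasis.det x| := le_mul_of_one_le_left (abs_nonneg _) hdet
    _ = |b.toBasis.det (D ∘ x)| := by rw [Basis.det_comp, abs_mul]
    _ ≤ ∏ i, ‖D (x i)‖ := b.abs_det_le_prod_norm _
    _ ≤ ∏ _i : Fin (2 * m), √(2 * τ * ρ) :=
        Finset.prod_le_prod (fun _ _ => norm_nonneg _) fun i _ => Real.le_sqrt_of_sq_le (hnorm i)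
    _ = (2 * τ * ρ) ^ m := by
        rw [Finset.prod_const, Finset.card_univ, Fintype.card_fin, pow_mul,
          Real.sq_sqrt (by positivity)]

theorem linearIndependent_of_pos_le_norm_sub {n : ℕ} {x : Fin n → E} {a : Fin n → ℝ}
    (ha0 : ∀ i, 0 < a i) (ha : ∀ i, ∀ z ∈ span ℝ (x '' Set.Iio i), a i ≤ ‖x i - z‖) :
    LinearIndependent ℝ x := by
  have hgs : LinearIndependent ℝ (gramSchmidt ℝ x) :=
    linearIndependent_of_ne_zero_of_inner_eq_zero
      (fun i => norm_pos_iff.1 ((ha0 i).trans_le (le_norm_gramSchmidt (ha i))))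
      fun _ _ => gramSchmidt_orthogonal ℝ x
  rw [linearIndependent_iff_card_eq_finrank_span] at hgs ⊢
  rw [hgs, Set.finrank, Set.finrank, span_gramSchmidt]

/-- Successive distances of `2 * m` elements are controlled by the distance to a subspace of
dimension at most `m`. -/
theorem prod_dist_le {m : ℕ} (V : Submodule ℝ E) [V.HasOrthogonalProjection]
    (g : Fin (2 * m) → E) {a : Fin (2 * m) → ℝ} (ha0 : ∀ i, 0 < a i)
    (ha : ∀ i, ∀ z ∈ V ⊔ span ℝ (g '' Set.Iio i), a i ≤ ‖g i - z‖)
    (Y : Submodule ℝ E) [FiniteDimensional ℝ Y] (hY : finrank ℝ Y ≤ m) {τ ρ : ℝ} (hρ : 0 < ρ)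
    (hρτ : ρ ≤ τ) (hgV : ∀ i, ‖g i - V.starProjection (g i)‖ ≤ τ)
    (hgY : ∀ i, ∃ y ∈ Y, ‖g i - y‖ ≤ ρ) :
    ∏ i, a i ≤ (2 * τ * ρ) ^ m := by
  set x : Fin (2 * m) → E := fun i => g i - V.starProjection (g i) with hx
  have hxa : ∀ i, ∀ z ∈ span ℝ (x '' Set.Iio i), a i ≤ ‖x i - z‖ := by
    intro i z hz
    have hsub : span ℝ (x '' Set.Iio i) ≤ V ⊔ span ℝ (g '' Set.Iio i) := by
      rw [span_le]
      rintro _ ⟨j, hj, rfl⟩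
      exact sub_mem (mem_sup_right (subset_span ⟨j, hj, rfl⟩))
        (mem_sup_left (V.starProjection_apply_mem _))
    have := ha i (V.starProjection (g i) + z)
      (add_mem (mem_sup_left (V.starProjection_apply_mem _)) (hsub hz))
    rwa [← sub_sub] at this
  have hli := linearIndependent_of_pos_le_norm_sub ha0 hxa
  let S : Submodule ℝ E := span ℝ (Set.range x)
  have hS : finrank ℝ S = 2 * m := by simpa using finrank_span_eq_card hli
  have hSfin : FiniteDimensional ℝ S := FiniteDimensional.span_of_finite ℝ (Set.finite_range x)
  have hSV : S ≤ Vᗮ := by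
    rw [span_le]
    rintro _ ⟨j, rfl⟩
    exact V.sub_starProjection_mem_orthogonal _
  let x' : Fin (2 * m) → S := fun i => ⟨x i, subset_span ⟨i, rfl⟩⟩
  have hproj : ∀ i, S.orthogonalProjectionOnto (g i) = x' i := by
    intro i
    have h1 : g i = (x' i : E) + V.starProjection (g i) := by simp [x', hx]
    rw [h1, map_add, orthogonalProjectionOnto_mem_subspace_eq_self,
      orthogonalProjectionOnto_apply_of_mem_orthogonal, add_zero]
    rw [mem_orthogonal]
    intro u hu
    rw [real_inner_comm]
    exact hSV hu _ (V.starProjection_apply_mem _)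
  refine prod_dist_le_of_finrank_eq hS x' ha0 ?_
    (Y.map (S.orthogonalProjectionOnto : E →ₗ[ℝ] S))
    ((finrank_map_le _ _).trans hY) hρ hρτ (fun i => hgV i) ?_
  · intro i z hz
    refine hxa i z ?_
    have := mem_map_of_mem (f := S.subtype) hz
    rw [map_span, ← Set.image_comp] at this
    exact this
  · intro i
    obtain ⟨y, hy, hyρ⟩ := hgY i
    refine ⟨_, mem_map_of_mem hy, ?_⟩
    rw [ContinuousLinearMap.coe_coe, ← hproj i, ← map_sub]
    exact (S.norm_orthogonalProjectionOnto_apply_le _).trans hyρ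

/-- Product estimate for weak greedy errors on an index window of length `2 * m`. -/
theorem weak_greedy_prod_le {F : Set E} {f : ℕ → E} (hfF : ∀ n, f n ∈ F) {γ : ℝ} (hγ0 : 0 < γ)
    (hγ1 : γ ≤ 1) {σ : ℕ → ℝ} (hσ0 : ∀ n, 0 ≤ σ n) (hanti : Antitone σ)
    (hσF : ∀ n, ∀ g ∈ F, infDist g (span ℝ (f '' Set.Iio n) : Set E) ≤ σ n)
    (hgreedy : ∀ n, γ * σ n ≤ infDist (f n) (span ℝ (f '' Set.Iio n) : Set E))
    (N m : ℕ) (Y : Submodule ℝ E) [FiniteDimensional ℝ Y] (hY : finrank ℝ Y ≤ m) {ρ : ℝ}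
    (hYF : ∀ g ∈ F, infDist g (Y : Set E) < ρ) :
    ∏ i : Fin (2 * m), γ * σ (N + i) ≤ (2 * σ N * ρ) ^ m := by
  have hρ : 0 < ρ := infDist_nonneg.trans_lt (hYF _ (hfF 0))
  have hσN := hσ0 N
  by_cases hz : ∃ i : Fin (2 * m), σ (N + i) = 0
  · obtain ⟨i, hi⟩ := hz
    rw [Finset.prod_eq_zero (Finset.mem_univ i) (by rw [hi, mul_zero])]
    positivity
  push Not at hz
  have hpos : ∀ i : Fin (2 * m), 0 < γ * σ (N + i) :=
    fun i => mul_pos hγ0 ((hσ0 _).lt_of_ne' (hz i))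
  rcases le_total ρ (σ N) with hρσ | hρσ
  · have : FiniteDimensional ℝ (span ℝ (f '' Set.Iio N)) :=
      FiniteDimensional.span_of_finite ℝ ((Set.finite_Iio N).image f)
    refine prod_dist_le (span ℝ (f '' Set.Iio N)) (fun i => f (N + i)) hpos ?_ Y hY hρ hρσ ?_ ?_
    · intro i z hz
      have hle : span ℝ (f '' Set.Iio N) ⊔ span ℝ ((fun j : Fin (2 * m) => f (N + j)) '' Set.Iio i)
          ≤ span ℝ (f '' Set.Iio (N + (i : ℕ))) := by
        refine sup_le (span_mono (Set.image_mono (Set.Iio_subset_Iio (by lia)))) (span_mono ?_)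
        rintro _ ⟨j, hj, rfl⟩
        exact ⟨N + j, Nat.add_lt_add_left hj N, rfl⟩
      rw [← dist_eq_norm]
      exact (hgreedy _).trans (infDist_le_dist_of_mem (hle hz))
    · intro i
      refine le_trans ?_ (hσF N _ (hfF (N + i)))
      refine (le_infDist ⟨0, zero_mem _⟩).2 fun y hy => ?_
      rw [dist_eq_norm]
      exact norm_sub_starProjection_le _ _ hy
    · intro i
      obtain ⟨y, hy, hlt⟩ := (infDist_lt_iff ⟨0, zero_mem Y⟩).1 (hYF _ (hfF (N + i)))
      exact ⟨y, hy, by rw [← dist_eq_norm]; exact hlt.le⟩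
  · calc ∏ i : Fin (2 * m), γ * σ (N + i) ≤ ∏ _i : Fin (2 * m), σ N :=
          Finset.prod_le_prod (fun i _ => (hpos i).le) fun i _ =>
            (mul_le_of_le_one_left (hσ0 _) hγ1).trans (hanti (Nat.le_add_right _ _))
      _ = (σ N * σ N) ^ m := by
          rw [Finset.prod_const, Finset.card_univ, Fintype.card_fin, pow_mul, sq]
      _ ≤ (2 * σ N * ρ) ^ m := by gcongr; nlinarith

/-- Bootstrapping step: polynomial decay follows from the halving inequality. -/
theorem poly_decay_of_sq_le {σ : ℕ → ℝ} (hanti : Antitone σ)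
    {α B : ℝ} (hα : 0 < α) (hB : 0 < B) (h1 : σ 1 ≤ B)
    (hsq : ∀ s : ℕ, 1 ≤ s → σ (4 * s) ^ 2 ≤ σ (2 * s) * (B * (s : ℝ) ^ (-α))) :
    ∀ n : ℕ, 1 ≤ n → σ n ≤ 2 ^ (5 * α) * B * (n : ℝ) ^ (-α) := by
  intro n
  induction n using Nat.strong_induction_on with
  | _ n ih =>
  intro hn
  have hn0 : (0 : ℝ) < n := by exact_mod_cast hn
  rcases lt_or_ge n 4 with h4 | h4
  · have hn4 : (4 : ℝ) ^ (-α) ≤ (n : ℝ) ^ (-α) :=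
      Real.rpow_le_rpow_of_nonpos hn0 (by exact_mod_cast h4.le) (by linarith)
    have h44 : (4 : ℝ) ^ (-α) = 2 ^ (-2 * α) := by
      rw [show (4 : ℝ) = 2 ^ (2 : ℝ) by norm_num, ← Real.rpow_mul (by norm_num)]
      ring_nf
    have hone : (1 : ℝ) ≤ 2 ^ (5 * α) * 2 ^ (-2 * α) := by
      rw [← Real.rpow_add (by norm_num)]
      exact Real.one_le_rpow (by norm_num) (by linarith)
    calc σ n ≤ σ 1 := hanti hn
      _ ≤ 1 * B := by rwa [one_mul]
      _ ≤ (2 ^ (5 * α) * 2 ^ (-2 * α)) * B := by gcongr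
      _ = 2 ^ (5 * α) * B * 2 ^ (-2 * α) := by ring
      _ ≤ 2 ^ (5 * α) * B * (n : ℝ) ^ (-α) := by rw [← h44]; gcongr
  · obtain ⟨s, hs1, hsn, hns⟩ : ∃ s, 1 ≤ s ∧ 4 * s ≤ n ∧ n ≤ 8 * s := ⟨n / 4, by lia⟩
    have hs0 : (0 : ℝ) < s := by exact_mod_cast hs1
    have hihs := ih (2 * s) (by lia) (by lia)
    set u : ℝ := (s : ℝ) ^ (-α) with hu
    set p : ℝ := (2 : ℝ) ^ α with hp
    have hu0 : 0 < u := by positivity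
    have hp1 : 1 ≤ p := Real.one_le_rpow (by norm_num) hα.le
    have hp0 : 0 < p := by linarith
    have h5 : (2 : ℝ) ^ (5 * α) = p ^ 5 := by
      rw [mul_comm, Real.rpow_mul (by norm_num)]; norm_cast
    have h2s : ((2 * s : ℕ) : ℝ) ^ (-α) = p⁻¹ * u := by
      push_cast
      rw [Real.mul_rpow (by norm_num) hs0.le, Real.rpow_neg (by norm_num) α]
    have h8 : (8 : ℝ) ^ (-α) = p⁻¹ ^ 3 := by
      rw [Real.rpow_neg (by norm_num), show (8 : ℝ) = 2 ^ 3 by norm_num, inv_pow,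
        ← Real.rpow_natCast, ← Real.rpow_natCast, ← Real.rpow_mul (by norm_num),
        ← Real.rpow_mul (by norm_num), mul_comm]
    have hnu : p⁻¹ ^ 3 * u ≤ (n : ℝ) ^ (-α) := by
      rw [← h8, hu, ← Real.mul_rpow (by norm_num) hs0.le]
      exact Real.rpow_le_rpow_of_nonpos hn0 (by exact_mod_cast hns) (by linarith)
    rw [h2s, h5] at hihs
    rw [h5]
    refine le_trans ?_ (mul_le_mul_of_nonneg_left hnu (by positivity : 0 ≤ p ^ 5 * B))
    refine (hanti hsn).trans (abs_le_of_sq_le_sq' ?_ (by positivity)).2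
    calc σ (4 * s) ^ 2 ≤ σ (2 * s) * (B * u) := hsq s hs1
      _ ≤ p ^ 5 * B * (p⁻¹ * u) * (B * u) := by gcongr
      _ = (p ^ 5 * B * (p⁻¹ ^ 3 * u)) ^ 2 := by field_simp

end WeakGreedy

/-- Corollary 3.2 (ii): polynomial decay of widths implies polynomial decay of greedy errors. -/
theorem weak_greedy_hilbert_poly
    {H : Type*} [NormedAddCommGroup H] [InnerProductSpace ℝ H] [CompleteSpace H]
    (γ : ℝ) (hγ0 : 0 < γ) (hγ1 : γ ≤ 1)
    (F : Set H) (hFc : IsCompact F) (hFb : ∀ g ∈ F, ‖g‖ ≤ 1)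
    (f : ℕ → H) (hfF : ∀ n, f n ∈ F)
    (σ : ℕ → ℝ)
    (hσ : ∀ n, σ n =
      sSup ((fun g => infDist g ((span ℝ (f '' Set.Iio n) : Submodule ℝ H) : Set H)) '' F))
    (hgreedy : ∀ n, γ * σ n ≤
      infDist (f n) ((span ℝ (f '' Set.Iio n) : Submodule ℝ H) : Set H))
    (d : ℕ → ℝ)
    (hd : ∀ m, d m =
      ⨅ Y : {Y : Submodule ℝ H // FiniteDimensional ℝ Y ∧ Module.finrank ℝ Y ≤ m},
        sSup ((fun g => infDist g ((Y : Submodule ℝ H) : Set H)) '' F))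
    (α C₀ : ℝ) (hα : 0 < α) (hC₀ : 0 < C₀)
    (hdecay : ∀ n : ℕ, 1 ≤ n → d n ≤ C₀ * (n : ℝ) ^ (-α)) :
    ∀ n : ℕ, 1 ≤ n → σ n ≤ (2 : ℝ) ^ (5 * α + 1) * γ⁻¹ ^ 2 * C₀ * (n : ℝ) ^ (-α) := by
  have hbdd : ∀ Y : Submodule ℝ H, BddAbove ((fun g => infDist g (Y : Set H)) '' F) := by
    rintro Y
    refine ⟨1, ?_⟩
    rintro _ ⟨g, hg, rfl⟩
    exact (infDist_le_dist_of_mem (zero_mem Y)).trans (by simpa using hFb g hg)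
  have hσF : ∀ n, ∀ g ∈ F, infDist g (span ℝ (f '' Set.Iio n) : Set H) ≤ σ n := by
    intro n g hg
    rw [hσ n]
    exact le_csSup (hbdd _) ⟨g, hg, rfl⟩
  have hσ0 : ∀ n, 0 ≤ σ n := fun n => infDist_nonneg.trans (hσF n _ (hfF 0))
  have hanti : Antitone σ := by
    intro k n hkn
    rw [hσ n]
    refine csSup_le ⟨_, f 0, hfF 0, rfl⟩ ?_
    rintro _ ⟨g, hg, rfl⟩
    exact (infDist_le_infDist_of_subset
      (span_mono (Set.image_mono (Set.Iio_subset_Iio hkn))) ⟨0, zero_mem _⟩).trans (hσF k g hg)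
  have hprod : ∀ N m : ℕ, 1 ≤ m →
      ∏ i : Fin (2 * m), γ * σ (N + i) ≤ (2 * σ N * (C₀ * (m : ℝ) ^ (-α))) ^ m := by
    intro N m hm
    have hlt : ∀ ρ, C₀ * (m : ℝ) ^ (-α) < ρ →
        ∏ i : Fin (2 * m), γ * σ (N + i) ≤ (2 * σ N * ρ) ^ m := by
      intro ρ hρ
      have : Nonempty {Y : Submodule ℝ H // FiniteDimensional ℝ Y ∧ Module.finrank ℝ Y ≤ m} :=
        ⟨⟨⊥, inferInstance, by simp⟩⟩
      obtain ⟨⟨Y, hYfin, hY⟩, hYρ⟩ :=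
        exists_lt_of_ciInf_lt ((hd m).symm.trans_lt ((hdecay m hm).trans_lt hρ))
      exact weak_greedy_prod_le hfF hγ0 hγ1 hσ0 hanti hσF hgreedy N m Y hY
        fun g hg => (le_csSup (hbdd Y) ⟨g, hg, rfl⟩).trans_lt hYρ
    have hcont : Continuous fun ρ : ℝ => (2 * σ N * ρ) ^ m := by fun_prop
    exact ge_of_tendsto (hcont.continuousWithinAt (s := Set.Ioi _))
      (Filter.eventually_of_mem self_mem_nhdsWithin hlt)
  have hγ2 : 0 < γ ^ 2 := by positivity
  have h1 : σ 1 ≤ 2 * γ⁻¹ ^ 2 * C₀ := by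
    have h : ∏ i : Fin 2, γ * σ (0 + i) ≤ (2 * σ 0 * (C₀ * ((1 : ℕ) : ℝ) ^ (-α))) ^ 1 :=
      hprod 0 1 le_rfl
    simp only [Fin.prod_univ_two, Fin.val_zero, Fin.val_one, Nat.cast_one,
      Real.one_rpow, mul_one, pow_one, zero_add] at h
    rw [inv_pow, ← div_eq_mul_inv, div_mul_eq_mul_div, le_div_iff₀ hγ2]
    rcases (hσ0 0).eq_or_lt with h0 | h0
    · have : σ 1 ≤ 0 := h0 ▸ hanti zero_le_one
      nlinarith
    · refine le_of_mul_le_mul_left ?_ h0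
      linarith
  have hsq : ∀ s : ℕ, 1 ≤ s →
      σ (4 * s) ^ 2 ≤ σ (2 * s) * (2 * γ⁻¹ ^ 2 * C₀ * (s : ℝ) ^ (-α)) := by
    intro s hs
    have h : ((γ * σ (4 * s)) ^ 2) ^ s ≤ (2 * σ (2 * s) * (C₀ * (s : ℝ) ^ (-α))) ^ s := by
      refine le_trans ?_ (hprod (2 * s) s hs)
      have hconst : ((γ * σ (4 * s)) ^ 2) ^ s = ∏ _i : Fin (2 * s), γ * σ (4 * s) := by
        rw [Finset.prod_const, Finset.card_univ, Fintype.card_fin, pow_mul]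
      rw [hconst]
      refine Finset.prod_le_prod (fun _ _ => mul_nonneg hγ0.le (hσ0 _)) fun i _ => ?_
      exact mul_le_mul_of_nonneg_left (hanti (by lia)) hγ0.le
    have hle := le_of_pow_le_pow_left₀ (by lia) (by have := hσ0 (2 * s); positivity) h
    rw [mul_pow, ← le_div_iff₀' hγ2] at hle
    refine hle.trans_eq ?_
    field_simp
  intro n hn
  refine (poly_decay_of_sq_le hanti hα (by positivity) h1 hsq n hn).trans_eq ?_
  rw [Real.rpow_add_one (by norm_num)]
  ring
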